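/- arXiv:1401.1477 — 3 statements merged into one kernel-verified Lean document; each statement's English description precedes it below -/
import Mathlib

section
/- For every constant c > 0 there exist constants α > 0 and N such that the following holds for all n ≥ N. Let p₁, …, pₙ be distinct points in the Euclidean plane ℝ² in general position, meaning that no point x ∈ ℝ² is equidistant from four or more of the points p₁, …, pₙ. Let σ be a uniformly random permutation of {1, …, n}, determining an ordering of the points in which pᵢ precedes pⱼ iff σ(i) < σ(j). For x ∈ ℝ², define the flirting set of x as the set of indices i such that dist(x, pᵢ) ≤ dist(x, pⱼ) for every j with σ(j) ≤ σ(i). Then, with probability at least 1 − n^{−c} over the choice of σ, simultaneously for every point x ∈ ℝ² the flirting set of x has cardinality at most α·log n. -/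
open scoped Classical

open Finset

section LinearShattering

variable {X ι E : Type*} [DecidableEq ι] [AddCommGroup E] [Module ℝ E] [FiniteDimensional ℝ E]

/-- The sets of indices on which a family of linear conditions `φ x (v i) ≤ 0` holds, as `x` varies,
shatter no set larger than the dimension. -/
theorem card_le_finrank_of_shatters (v : ι → E) (φ : X → E →ₗ[ℝ] ℝ) (𝒜 : Finset (Finset ι))
    (h𝒜 : ∀ A ∈ 𝒜, ∃ x, ∀ i, i ∈ A ↔ φ x (v i) ≤ 0) {s : Finset ι} (hs : 𝒜.Shatters s) :
    s.card ≤ Module.finrank ℝ E := by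
  have nonneg : ∀ g : s → ℝ, ∑ i, g i • v i = 0 → ∀ i, 0 ≤ g i := by
    intro g hg i
    by_contra! hi
    obtain ⟨u, hu, hsu⟩ := hs (t := (univ.filter fun i : s => 0 ≤ g i).map
      (Function.Embedding.subtype _)) (by intro a; simp; tauto)
    obtain ⟨x, hx⟩ := h𝒜 u hu
    have hmem : ∀ j : s, φ x (v j) ≤ 0 ↔ 0 ≤ g j := by
      intro j
      have := congrArg (fun t => (j : ι) ∈ t) hsu
      simp at this
      rw [← hx, this]
    have hsum : ∑ j, g j * φ x (v j) = 0 := by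
      simpa using congrArg (φ x) hg
    have hneg : ∑ j, g j * φ x (v j) < 0 := by
      refine Finset.sum_neg' (fun j _ => ?_) ⟨i, mem_univ i, ?_⟩
      · rcases le_or_gt 0 (g j) with hj | hj
        · exact mul_nonpos_of_nonneg_of_nonpos hj ((hmem j).2 hj)
        · exact (mul_neg_of_neg_of_pos hj (not_le.1 fun h => hj.not_ge ((hmem j).1 h))).le
      · exact mul_neg_of_neg_of_pos hi (not_le.1 fun h => hi.not_ge ((hmem i).1 h))
    linarith
  have hli : LinearIndependent ℝ fun i : s => v i := by
    refine Fintype.linearIndependent_iff.2 fun g hg i => le_antisymm ?_ (nonneg g hg i)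
    have := nonneg (fun j => -g j) (by simpa using hg) i
    linarith
  simpa using hli.fintype_card_le_finrank

end LinearShattering

/-- The comparison pattern of the distances from `x` to the points `p i`. -/
noncomputable def distPattern {n : ℕ} (p : Fin n → EuclideanSpace ℝ (Fin 2))
    (x : EuclideanSpace ℝ (Fin 2)) : Finset (Fin n × Fin n) :=
  univ.filter fun a => dist x (p a.1) ≤ dist x (p a.2)

theorem card_le_three_of_shatters_distPattern {n : ℕ} (p : Fin n → EuclideanSpace ℝ (Fin 2))
    (𝒜 : Finset (Finset (Fin n × Fin n))) (h𝒜 : ∀ A ∈ 𝒜, ∃ x, distPattern p x = A)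
    {s : Finset (Fin n × Fin n)} (hs : 𝒜.Shatters s) : s.card ≤ 3 := by
  have := card_le_finrank_of_shatters (E := EuclideanSpace ℝ (Fin 2) × ℝ)
    (fun a => (p a.1 - p a.2, ‖p a.1‖ ^ 2 - ‖p a.2‖ ^ 2))
    (fun x => (-2 : ℝ) • (innerₗ _ x).comp (LinearMap.fst ℝ _ _) + LinearMap.snd ℝ _ _) 𝒜
    (fun A hA => by
      obtain ⟨x, rfl⟩ := h𝒜 A hA
      refine ⟨x, fun a => ?_⟩
      rw [distPattern, mem_filter, dist_eq_norm, dist_eq_norm,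
        ← sq_le_sq₀ (norm_nonneg _) (norm_nonneg _), norm_sub_sq_real, norm_sub_sq_real]
      simp [inner_sub_right]
      constructor <;> intro h <;> linarith) hs
  simpa using this

theorem card_distPatterns_le {n : ℕ} (hn : 1 ≤ n) (p : Fin n → EuclideanSpace ℝ (Fin 2))
    (𝒜 : Finset (Finset (Fin n × Fin n))) (h𝒜 : ∀ A ∈ 𝒜, ∃ x, distPattern p x = A) :
    𝒜.card ≤ 4 * n ^ 6 := by
  have hvc : 𝒜.vcDim ≤ 3 := Finset.sup_le fun s hs =>
    card_le_three_of_shatters_distPattern p 𝒜 h𝒜 (mem_shatterer.1 hs)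
  calc 𝒜.card ≤ 𝒜.shatterer.card := card_le_card_shatterer 𝒜
    _ ≤ ∑ k ∈ Iic 𝒜.vcDim, (Fintype.card (Fin n × Fin n)).choose k :=
      card_shatterer_le_sum_vcDim
    _ ≤ ∑ k ∈ Iic 3, (Fintype.card (Fin n × Fin n)).choose k :=
      sum_le_sum_of_subset (Iic_subset_Iic.2 hvc)
    _ ≤ ∑ _k ∈ Iic 3, n ^ 6 := by
      refine sum_le_sum fun k hk => ?_
      rw [mem_Iic] at hk
      calc (Fintype.card (Fin n × Fin n)).choose k ≤ (Fintype.card (Fin n × Fin n)) ^ k :=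
            Nat.choose_le_pow _ _
        _ = n ^ (2 * k) := by simp [← pow_two, pow_mul]
        _ ≤ n ^ 6 := Nat.pow_le_pow_right hn (by omega)
    _ = 4 * n ^ 6 := by simp

/-- The indices at which `d` attains a weak prefix minimum, in the order given by `σ`. -/
noncomputable def prefixMinima {n : ℕ} (d : Fin n → ℝ) (σ : Equiv.Perm (Fin n)) : Finset (Fin n) :=
  univ.filter fun i => ∀ j, σ j ≤ σ i → d i ≤ d j

/-- The permutation sending `i` to the last position and ordering the other indices by `τ`. -/
def permOfLast {n : ℕ} (a : Fin (n + 1) × Equiv.Perm (Fin n)) : Equiv.Perm (Fin (n + 1)) :=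
  ((finSuccEquiv' a.1).trans (Equiv.optionCongr a.2)).trans (finSuccEquiv' (Fin.last n)).symm

theorem permOfLast_self {n : ℕ} (i : Fin (n + 1)) (τ : Equiv.Perm (Fin n)) :
    permOfLast (i, τ) i = Fin.last n := by
  simp [permOfLast]

theorem permOfLast_succAbove {n : ℕ} (i : Fin (n + 1)) (τ : Equiv.Perm (Fin n)) (k : Fin n) :
    permOfLast (i, τ) (i.succAbove k) = (τ k).castSucc := by
  simp [permOfLast]

theorem permOfLast_bijective (n : ℕ) : Function.Bijective (permOfLast (n := n)) := by
  refine (Fintype.bijective_iff_injective_and_card _).2 ⟨?_, ?_⟩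
  · rintro ⟨i, τ⟩ ⟨j, ρ⟩ h
    have hij : i = j := by
      apply (permOfLast (i, τ)).injective
      rw [permOfLast_self, h, permOfLast_self]
    subst hij
    refine Prod.ext rfl (Equiv.ext fun k => ?_)
    have := congrArg (fun e : Equiv.Perm (Fin (n + 1)) => e (i.succAbove k)) h
    simpa [permOfLast_succAbove] using this
  · simp [Fintype.card_perm, Nat.factorial_succ]

theorem card_prefixMinima_permOfLast {n : ℕ} (d : Fin (n + 1) → ℝ) (i : Fin (n + 1))
    (τ : Equiv.Perm (Fin n)) :
    (prefixMinima d (permOfLast (i, τ))).card =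
      (if ∀ j, d i ≤ d j then 1 else 0) + (prefixMinima (d ∘ i.succAbove) τ).card := by
  rw [prefixMinima, prefixMinima, card_filter, card_filter, Fin.sum_univ_succAbove _ i]
  congr 1
  · simp [permOfLast_self, Fin.le_last]
  · refine sum_congr rfl fun k _ => ?_
    simp [Fin.forall_iff_succAbove i, permOfLast_self, permOfLast_succAbove, Fin.last_le_iff,
      Fin.castSucc_ne_last]

theorem sum_two_pow_card_prefixMinima_le :
    ∀ {n : ℕ} (d : Fin n → ℝ), (∀ r, (univ.filter fun i => d i = r).card ≤ 3) →
      6 * ∑ σ, 2 ^ (prefixMinima d σ).card ≤ (n + 3).factorial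
  | 0, d, _ => by simp [prefixMinima, Nat.factorial]
  | n + 1, d, hd => by
    have hrec : ∀ i : Fin (n + 1),
        6 * ∑ τ, 2 ^ (prefixMinima (d ∘ i.succAbove) τ).card ≤ (n + 3).factorial := by
      refine fun i => sum_two_pow_card_prefixMinima_le _ fun r => le_trans ?_ (hd r)
      refine card_le_card_of_injOn i.succAbove (fun k hk => by simpa using hk)
        (Fin.succAbove_right_injective.injOn)
    have hmin : (univ.filter fun i => ∀ j, d i ≤ d j).card ≤ 3 := by
      obtain ⟨m, hm⟩ := Finite.exists_min d
      refine le_trans (card_le_card fun i hi => ?_) (hd (d m))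
      simp only [mem_filter, mem_univ, true_and] at hi ⊢
      exact le_antisymm (hi m) (hm i)
    have hweight : ∑ i, 2 ^ (if ∀ j, d i ≤ d j then 1 else 0) ≤ n + 4 := by
      have : ∀ i, 2 ^ (if ∀ j, d i ≤ d j then 1 else 0) = 1 + if ∀ j, d i ≤ d j then 1 else 0 := by
        intro i; split_ifs <;> rfl
      rw [sum_congr rfl fun i _ => this i, sum_add_distrib, ← card_filter]
      simp only [sum_const, card_univ, Fintype.card_fin, smul_eq_mul]
      omega
    rw [← (permOfLast_bijective n).sum_comp, Fintype.sum_prod_type]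
    simp only [card_prefixMinima_permOfLast, pow_add]
    calc 6 * ∑ i, ∑ τ, 2 ^ (if ∀ j, d i ≤ d j then 1 else 0) *
            2 ^ (prefixMinima (d ∘ i.succAbove) τ).card
        = ∑ i, 2 ^ (if ∀ j, d i ≤ d j then 1 else 0) *
            (6 * ∑ τ, 2 ^ (prefixMinima (d ∘ i.succAbove) τ).card) := by
          rw [mul_sum]
          refine sum_congr rfl fun i _ => ?_
          rw [← mul_sum]; ring
      _ ≤ ∑ i, 2 ^ (if ∀ j, d i ≤ d j then 1 else 0) * (n + 3).factorial :=
          sum_le_sum fun i _ => Nat.mul_le_mul_left _ (hrec i)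
      _ = (∑ i, 2 ^ (if ∀ j, d i ≤ d j then 1 else 0)) * (n + 3).factorial := by rw [sum_mul]
      _ ≤ (n + 4) * (n + 3).factorial := Nat.mul_le_mul_right _ hweight
      _ = (n + 1 + 3).factorial := (Nat.factorial_succ _).symm

theorem sum_two_pow_card_prefixMinima_le_mul {n : ℕ} (hn : 3 ≤ n) (d : Fin n → ℝ)
    (hd : ∀ r, (univ.filter fun i => d i = r).card ≤ 3) :
    ∑ σ, 2 ^ (prefixMinima d σ).card ≤ 2 * n ^ 3 * n.factorial := by
  have h := sum_two_pow_card_prefixMinima_le d hd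
  have hprod : (n + 3) * ((n + 2) * (n + 1)) ≤ (2 * n) * ((2 * n) * (2 * n)) := by
    gcongr <;> omega
  have hfac : (n + 3).factorial = (n + 3) * ((n + 2) * (n + 1)) * n.factorial := by
    simp only [Nat.factorial_succ]; ring
  have := Nat.mul_le_mul_right n.factorial hprod
  rw [hfac] at h
  linarith

theorem card_prefixMinima_gt_mul_le {n : ℕ} (hn : 3 ≤ n) (d : Fin n → ℝ)
    (hd : ∀ r, (univ.filter fun i => d i = r).card ≤ 3) (t : ℝ) :
    ((univ.filter fun σ => t < ((prefixMinima d σ).card : ℝ)).card : ℝ) * (2 : ℝ) ^ t ≤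
      2 * n ^ 3 * n.factorial := by
  have h : ((∑ σ, 2 ^ (prefixMinima d σ).card : ℕ) : ℝ) ≤ 2 * n ^ 3 * n.factorial := by
    exact_mod_cast sum_two_pow_card_prefixMinima_le_mul hn d hd
  refine le_trans ?_ h
  rw [← nsmul_eq_mul, ← sum_const]
  push_cast
  refine (sum_le_sum fun σ hσ => ?_).trans
    (sum_le_sum_of_subset_of_nonneg (filter_subset _ _) fun _ _ _ => by positivity)
  rw [← Real.rpow_natCast]
  exact Real.rpow_le_rpow_of_exponent_le one_le_two (mem_filter.1 hσ).2.le

theorem prefixMinima_dist_eq_of_distPattern_eq {n : ℕ} {p : Fin n → EuclideanSpace ℝ (Fin 2)}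
    {x y : EuclideanSpace ℝ (Fin 2)} (h : distPattern p x = distPattern p y)
    (σ : Equiv.Perm (Fin n)) :
    prefixMinima (fun i => dist x (p i)) σ = prefixMinima (fun i => dist y (p i)) σ := by
  have hxy : ∀ i j, dist x (p i) ≤ dist x (p j) ↔ dist y (p i) ≤ dist y (p j) := fun i j => by
    simpa [distPattern] using congrArg (fun A => (i, j) ∈ A) h
  simp only [prefixMinima, hxy]

theorem card_exists_prefixMinima_gt_mul_le {n : ℕ} (hn : 3 ≤ n)
    (p : Fin n → EuclideanSpace ℝ (Fin 2))
    (hp : ∀ x r, (univ.filter fun i => dist x (p i) = r).card ≤ 3) (t : ℝ) :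
    ((univ.filter fun σ => ∃ x, t < ((prefixMinima (fun i => dist x (p i)) σ).card : ℝ)).card : ℝ) *
      (2 : ℝ) ^ t ≤ 8 * n ^ 9 * n.factorial := by
  set 𝒜 : Finset (Finset (Fin n × Fin n)) := univ.filter fun A => ∃ x, distPattern p x = A
  have h𝒜 : ∀ A ∈ 𝒜, ∃ x, distPattern p x = A := fun A hA => (mem_filter.1 hA).2
  choose! y hy using h𝒜
  have hsub : (univ.filter fun σ => ∃ x, t < ((prefixMinima (fun i => dist x (p i)) σ).card : ℝ)) ⊆
      𝒜.biUnion fun A =>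
        univ.filter fun σ => t < ((prefixMinima (fun i => dist (y A) (p i)) σ).card : ℝ) := by
    intro σ hσ
    obtain ⟨x, hx⟩ := (mem_filter.1 hσ).2
    have hA : distPattern p x ∈ 𝒜 := mem_filter.2 ⟨mem_univ _, x, rfl⟩
    refine mem_biUnion.2 ⟨_, hA, mem_filter.2 ⟨mem_univ _, ?_⟩⟩
    rwa [prefixMinima_dist_eq_of_distPattern_eq (hy _ hA)]
  have hcard : (𝒜.card : ℝ) ≤ 4 * n ^ 6 := by
    exact_mod_cast card_distPatterns_le (by omega) p 𝒜 fun A hA => ⟨y A, hy A hA⟩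
  calc _ ≤ ((∑ A ∈ 𝒜, (univ.filter fun σ =>
          t < ((prefixMinima (fun i => dist (y A) (p i)) σ).card : ℝ)).card : ℕ) : ℝ) *
            (2 : ℝ) ^ t := by
        gcongr
        exact (card_le_card hsub).trans card_biUnion_le
    _ ≤ ∑ _A ∈ 𝒜, (2 * n ^ 3 * n.factorial : ℝ) := by
        push_cast
        rw [sum_mul]
        exact sum_le_sum fun A _ => card_prefixMinima_gt_mul_le hn _ (hp (y A)) t
    _ = 𝒜.card * (2 * n ^ 3 * n.factorial : ℝ) := by simp
    _ ≤ 4 * n ^ 6 * (2 * n ^ 3 * n.factorial) := by gcongr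
    _ = 8 * n ^ 9 * n.factorial := by ring

/-- For distinct points in the plane in general position (no point of the plane is
equidistant from four or more of them) and a uniformly random insertion order `σ`,
with probability at least `1 - n ^ (-c)`, simultaneously for every point `x` of the
plane the flirting set of `x` has cardinality at most `α · log n`. -/
theorem flirting_sets_small_whp :
    ∀ c : ℝ, 0 < c → ∃ α : ℝ, 0 < α ∧ ∃ N : ℕ, ∀ n : ℕ, N ≤ n →
      ∀ p : Fin n → EuclideanSpace ℝ (Fin 2), Function.Injective p →
      (∀ x : EuclideanSpace ℝ (Fin 2), ∀ r : ℝ,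
          (Finset.univ.filter fun i : Fin n => dist x (p i) = r).card ≤ 3) →
      (1 : ℝ) - (n : ℝ) ^ (-c) ≤
        ((Finset.univ.filter fun σ : Equiv.Perm (Fin n) =>
            ∀ x : EuclideanSpace ℝ (Fin 2),
              ((Finset.univ.filter fun i : Fin n =>
                  ∀ j : Fin n, σ j ≤ σ i → dist x (p i) ≤ dist x (p j)).card : ℝ) ≤
                α * Real.log n).card : ℝ) / (Nat.factorial n : ℝ) := by
  intro c hc
  have hlog : 0 < Real.log 2 := Real.log_pos one_lt_two
  refine ⟨(c + 11) / Real.log 2, by positivity, 3, fun n hn p _ hp => ?_⟩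
  have hn0 : (0 : ℝ) < n := by exact_mod_cast (by omega : 0 < n)
  have hn3 : (3 : ℝ) ≤ n := by exact_mod_cast hn
  have hfac : (0 : ℝ) < n.factorial := by exact_mod_cast n.factorial_pos
  have hpow : (2 : ℝ) ^ ((c + 11) / Real.log 2 * Real.log n) = (n : ℝ) ^ c * (n : ℝ) ^ 11 := by
    rw [← Real.rpow_add_natCast hn0.ne', Real.rpow_def_of_pos two_pos, Real.rpow_def_of_pos hn0]
    congr 1
    push_cast
    field_simp
  have hbad := card_exists_prefixMinima_gt_mul_le hn p hp ((c + 11) / Real.log 2 * Real.log n)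
  rw [hpow] at hbad
  set t := (c + 11) / Real.log 2 * Real.log n
  set good := univ.filter fun σ : Equiv.Perm (Fin n) =>
    ∀ x, ((prefixMinima (fun i => dist x (p i)) σ).card : ℝ) ≤ t
  set bad := univ.filter fun σ : Equiv.Perm (Fin n) =>
    ∃ x, t < ((prefixMinima (fun i => dist x (p i)) σ).card : ℝ)
  have htotal : (good.card : ℝ) + bad.card = n.factorial := by
    have h := card_filter_add_card_filter_not (s := (univ : Finset (Equiv.Perm (Fin n))))
      fun σ => ∀ x, ((prefixMinima (fun i => dist x (p i)) σ).card : ℝ) ≤ t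
    simp only [not_forall, not_le, card_univ, Fintype.card_perm, Fintype.card_fin] at h
    exact_mod_cast h
  have hc0 : 0 < (n : ℝ) ^ c := Real.rpow_pos_of_pos hn0 c
  have hsmall : (bad.card : ℝ) * (n : ℝ) ^ c ≤ n.factorial := by
    refine le_of_mul_le_mul_right (a := (n : ℝ) ^ 11) ?_ (by positivity)
    calc (bad.card : ℝ) * (n : ℝ) ^ c * (n : ℝ) ^ 11 ≤ (8 * n ^ 9 * n.factorial : ℝ) := by
          rw [mul_assoc]; exact hbad
      _ ≤ (n ^ 2 * n ^ 9 * n.factorial : ℝ) := by gcongr; nlinarith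
      _ = n.factorial * (n : ℝ) ^ 11 := by ring
  change _ ≤ (good.card : ℝ) / n.factorial
  rw [le_div_iff₀ hfac, Real.rpow_neg hn0.le, sub_mul, one_mul, inv_mul_eq_div]
  have := (le_div_iff₀ hc0).2 hsmall
  linarith
end

section
/- Let f₁, …, fₙ : ℝ → ℝ be functions in general position, meaning there is no t ∈ ℝ at which three distinct functions take a common value. Suppose λ : ℕ → ℕ is such that for every subset S ⊆ {1, …, n}, the vertex set Vert(S) of the lower envelope of {fᵢ : i ∈ S} is finite and has cardinality at most λ(|S|). Let σ be a uniformly random permutation of {1, …, n}, and for 0 ≤ i ≤ n let Sᵢ(σ) denote the set of the first i indices in the ordering induced by σ. Then the expected overlay complexity satisfies E[ ∑_{i=1}^{n} |Vert(Sᵢ(σ)) \ Vert(S_{i−1}(σ))| ] ≤ ∑_{i=1}^{n} 2·λ(i)/i; that is, the expected total number of new lower-envelope vertices created over the course of the random incremental insertion of the functions is at most ∑_{i=1}^{n} 2λ(i)/i. -/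
/-- The vertex set of the lower envelope of the functions `f i`, `i ∈ S`: the points
`(t, y)` of the plane with `y = min_{i ∈ S} f i t`, the minimum being attained by at
least two distinct indices of `S`. -/
def lowerEnvelopeVertices {n : ℕ} (f : Fin n → ℝ → ℝ) (S : Finset (Fin n)) :
    Set (ℝ × ℝ) :=
  {q : ℝ × ℝ | ∃ i ∈ S, ∃ j ∈ S, i ≠ j ∧ f i q.1 = q.2 ∧ f j q.1 = q.2 ∧
      ∀ k ∈ S, q.2 ≤ f k q.1}

open Finset in
/-- Each vertex of a lower envelope is destroyed by the removal of at most two of the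
functions. -/
theorem sum_ncard_lowerEnvelopeVertices_sdiff_erase_le {n : ℕ} (f : Fin n → ℝ → ℝ)
    (S : Finset (Fin n)) (hS : (lowerEnvelopeVertices f S).Finite) :
    ∑ a ∈ S, (lowerEnvelopeVertices f S \ lowerEnvelopeVertices f (S.erase a)).ncard ≤
      2 * (lowerEnvelopeVertices f S).ncard := by
  classical
  have hcard (a : Fin n) :
      (lowerEnvelopeVertices f S \ lowerEnvelopeVertices f (S.erase a)).ncard =
        #{q ∈ hS.toFinset | q ∉ lowerEnvelopeVertices f (S.erase a)} := by
    rw [← Set.ncard_coe_finset]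
    congr 1
    ext q
    simp
  simp_rw [hcard, card_filter]
  rw [sum_comm, Set.ncard_eq_toFinset_card _ hS, mul_comm, ← smul_eq_mul]
  refine sum_le_card_nsmul _ _ _ fun q hq ↦ ?_
  rw [← card_filter]
  obtain ⟨i, hi, j, hj, hij, hfi, hfj, hmin⟩ := hS.mem_toFinset.mp hq
  refine (card_le_card (t := {i, j}) fun a ha ↦ ?_).trans card_le_two
  by_contra hne
  simp only [mem_insert, mem_singleton, not_or] at hne
  exact (mem_filter.mp ha).2 ⟨i, mem_erase.mpr ⟨Ne.symm hne.1, hi⟩, j,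
    mem_erase.mpr ⟨Ne.symm hne.2, hj⟩, hij, hfi, hfj, fun k hk ↦ hmin k (mem_of_mem_erase hk)⟩

open Finset in
/-- Backwards analysis: given the unordered prefix of the elements in positions up to `p`,
the element in position `p` is uniformly distributed in that prefix. -/
theorem sum_perm_filter_le_symm_eq {n : ℕ} (p : Fin n) (g : Finset (Fin n) → Fin n → ℕ) :
    ((p : ℕ) + 1) * ∑ σ : Equiv.Perm (Fin n), g {j | σ j ≤ p} (σ.symm p) =
      ∑ σ : Equiv.Perm (Fin n), ∑ a ∈ ({j | σ j ≤ p} : Finset (Fin n)), g {j | σ j ≤ p} a := by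
  have hswap (k : Fin n) (hk : k ∈ Iic p) :
      ∑ σ : Equiv.Perm (Fin n), g {j | σ j ≤ p} (σ.symm k) =
        ∑ σ : Equiv.Perm (Fin n), g {j | σ j ≤ p} (σ.symm p) := by
    rw [mem_Iic] at hk
    refine Fintype.sum_equiv (Equiv.mulLeft (Equiv.swap k p)) _ _ fun σ ↦ ?_
    congr 1
    · ext j
      rw [mem_filter, mem_filter]
      simp only [mem_univ, true_and, Equiv.coe_mulLeft, Equiv.Perm.mul_apply,
        Equiv.swap_apply_def]
      split_ifs with h₁ h₂ <;> simp_all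
    · rw [Equiv.eq_symm_apply]
      simp
  have hsum (σ : Equiv.Perm (Fin n)) :
      ∑ a ∈ ({j | σ j ≤ p} : Finset (Fin n)), g {j | σ j ≤ p} a =
        ∑ k ∈ Iic p, g {j | σ j ≤ p} (σ.symm k) :=
    sum_equiv σ (by simp) (by simp)
  simp_rw [hsum]
  rw [sum_comm, sum_congr rfl hswap, sum_const, Fin.card_Iic, smul_eq_mul]

/-- Randomized incremental construction of the lower envelope: if every subset `S` of
the functions has a finite lower-envelope vertex set of cardinality at most `lam |S|`,
then inserting the functions in a uniformly random order, the expected total number of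
new lower-envelope vertices created is at most `∑_{i=1}^{n} 2 · lam i / i`.
Here `S_i(σ) = {j : σ j < i}` is the unordered prefix of the first `i` inserted
indices. -/
theorem expected_overlay_complexity_le
    (n : ℕ) (f : Fin n → ℝ → ℝ)
    (hgp : ∀ t : ℝ, ¬ ∃ i j k : Fin n, i ≠ j ∧ i ≠ k ∧ j ≠ k ∧
        f i t = f j t ∧ f i t = f k t)
    (lam : ℕ → ℕ)
    (hlam : ∀ S : Finset (Fin n), (lowerEnvelopeVertices f S).Finite ∧
        (lowerEnvelopeVertices f S).ncard ≤ lam S.card) :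
    (∑ σ : Equiv.Perm (Fin n), ∑ i ∈ Finset.range n,
        ((lowerEnvelopeVertices f (Finset.univ.filter fun j : Fin n => (σ j : ℕ) < i + 1) \
          lowerEnvelopeVertices f (Finset.univ.filter fun j : Fin n => (σ j : ℕ) < i)).ncard
            : ℝ)) / (Nat.factorial n : ℝ) ≤
      ∑ i ∈ Finset.range n, 2 * (lam (i + 1) : ℝ) / ((i : ℝ) + 1) := by
  rw [Finset.sum_comm, Finset.sum_div]
  refine Finset.sum_le_sum fun i hi ↦ ?_
  have hin : i < n := Finset.mem_range.mp hi
  let p : Fin n := ⟨i, hin⟩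
  let g (S : Finset (Fin n)) (a : Fin n) : ℕ :=
    (lowerEnvelopeVertices f S \ lowerEnvelopeVertices f (S.erase a)).ncard
  have hprefix (σ : Equiv.Perm (Fin n)) :
      (Finset.univ.filter fun j : Fin n => (σ j : ℕ) < i + 1) =
        Finset.univ.filter fun j ↦ σ j ≤ p := by
    ext j
    simp [p, Fin.le_def]
  have herase (σ : Equiv.Perm (Fin n)) :
      (Finset.univ.filter fun j : Fin n => (σ j : ℕ) < i) =
        (Finset.univ.filter fun j ↦ σ j ≤ p).erase (σ.symm p) := by
    ext j
    simp only [Finset.mem_filter, Finset.mem_univ, true_and, Finset.mem_erase, ne_eq,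
      Equiv.eq_symm_apply, Fin.ext_iff, Fin.le_def, p]
    omega
  have hcard (σ : Equiv.Perm (Fin n)) :
      (Finset.univ.filter fun j ↦ σ j ≤ p).card = i + 1 := by
    rw [← Fin.card_Iic p]
    exact Finset.card_equiv σ (by simp)
  have hbound : (i + 1) * ∑ σ : Equiv.Perm (Fin n),
      g (Finset.univ.filter fun j ↦ σ j ≤ p) (σ.symm p) ≤ n.factorial * (2 * lam (i + 1)) := by
    rw [show i = (p : ℕ) from rfl, sum_perm_filter_le_symm_eq p g]
    refine (Finset.sum_le_card_nsmul _ _ (2 * lam (i + 1)) fun σ _ ↦ ?_).trans ?_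
    · refine (sum_ncard_lowerEnvelopeVertices_sdiff_erase_le f _ (hlam _).1).trans ?_
      rw [← hcard σ]
      exact Nat.mul_le_mul_left 2 (hlam _).2
    · simp [Fintype.card_perm, p]
  simp_rw [hprefix, herase]
  rw [div_le_div_iff₀ (by positivity) (by positivity)]
  have hreal := (Nat.cast_le (α := ℝ)).mpr hbound
  push_cast [g] at hreal
  linarith
end

section
/- There exists N such that for all integers n ≥ N the following holds. Consider the 2n points indexed by pairs (m, b) with m ∈ {1, …, n} a column index and b ∈ {0, 1} a row index, and let σ be a uniformly random ordering of these 2n points (a uniformly random bijection from {1, …, 2n} to the set of points), where the point inserted at time t is σ(t). For an insertion time j with 1 ≤ j ≤ n/20, set ξ_j = ⌈n/(8j)⌉, and say that the j-th inserted point is isolated if, writing σ(j) = (x_j, r_j), every point (m, b) ≠ σ(j) with |m − x_j| ≤ ξ_j is inserted strictly after time j. Then for every j with 1 ≤ j ≤ n/20, the probability that the j-th inserted point is isolated is at least 1/2. -/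
open Finset in
/-- If every point has at most `d` neighbours for the relation `R`, then the probability that a
uniformly random bijection sends some element of `S ∌ j` to a neighbour of the image of `j` is at
most `#S * d / (|α| - 1)`. -/
theorem card_equiv_exists_rel_le {α β : Type*} [Fintype α] [DecidableEq α] [Fintype β]
    [DecidableEq β] (R : β → β → Prop) [∀ x y, Decidable (R x y)] (d : ℕ)
    (hd : ∀ x, #{y | y ≠ x ∧ R x y} ≤ d) (j : α) (S : Finset α) (hS : j ∉ S) :
    (Fintype.card α - 1) * #{σ : α ≃ β | ∃ i ∈ S, R (σ j) (σ i)} ≤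
      #S * (d * Fintype.card (α ≃ β)) := by
  have key : ∀ i, i ≠ j →
      (Fintype.card α - 1) * #{σ : α ≃ β | R (σ j) (σ i)} ≤ d * Fintype.card (α ≃ β) := by
    intro i hi
    have symm : ∀ i' ∈ univ.erase j,
        #{σ : α ≃ β | R (σ j) (σ i')} = #{σ : α ≃ β | R (σ j) (σ i)} := by
      intro i' hi'
      have hi' : i' ≠ j := by simpa using hi'
      refine card_bij' (fun σ _ => (Equiv.swap i i').trans σ)
        (fun σ _ => (Equiv.swap i i').trans σ) ?_ ?_ ?_ ?_
      · intro σ hσ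
        simpa [Equiv.swap_apply_of_ne_of_ne hi.symm hi'.symm] using hσ
      · intro σ hσ
        simpa [Equiv.swap_apply_of_ne_of_ne hi.symm hi'.symm] using hσ
      · intro σ _
        ext x
        simp
      · intro σ _
        ext x
        simp
    calc (Fintype.card α - 1) * #{σ : α ≃ β | R (σ j) (σ i)}
        = ∑ i' ∈ univ.erase j, #{σ : α ≃ β | R (σ j) (σ i')} := by
          rw [sum_congr rfl symm, sum_const, card_erase_of_mem (mem_univ j), card_univ,
            smul_eq_mul]
      _ = ∑ σ : α ≃ β, #{i' ∈ univ.erase j | R (σ j) (σ i')} :=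
          (sum_card_bipartiteAbove_eq_sum_card_bipartiteBelow
            fun (i' : α) (σ : α ≃ β) => R (σ j) (σ i'))
      _ ≤ ∑ _σ : α ≃ β, d := by
          refine sum_le_sum fun σ _ => le_trans ?_ (hd (σ j))
          refine card_le_card_of_injOn σ ?_ σ.injective.injOn
          intro x hx
          simpa using hx
      _ = d * Fintype.card (α ≃ β) := by
          rw [sum_const, card_univ, smul_eq_mul, mul_comm]
  have union : #{σ : α ≃ β | ∃ i ∈ S, R (σ j) (σ i)} ≤
      ∑ i ∈ S, #{σ : α ≃ β | R (σ j) (σ i)} := by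
    refine le_trans (card_le_card ?_) card_biUnion_le
    intro σ hσ
    simpa using hσ
  calc _ ≤ (Fintype.card α - 1) * ∑ i ∈ S, #{σ : α ≃ β | R (σ j) (σ i)} :=
        Nat.mul_le_mul_left _ union
    _ = ∑ i ∈ S, (Fintype.card α - 1) * #{σ : α ≃ β | R (σ j) (σ i)} := mul_sum _ _ _
    _ ≤ ∑ _i ∈ S, d * Fintype.card (α ≃ β) :=
        sum_le_sum fun i hi => key i fun h => hS (h ▸ hi)
    _ = _ := by rw [sum_const, smul_eq_mul]

open Finset in
/-- A point of the `n × 2` grid has at most `4 k + 1` other points within column distance `k`. -/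
theorem card_columns_near_le (n k : ℕ) (p : Fin n × Bool) :
    #{q : Fin n × Bool | q ≠ p ∧ |((q.1 : ℕ) : ℤ) - ((p.1 : ℕ) : ℤ)| ≤ k} ≤ 4 * k + 1 := by
  let T : Finset (ℤ × Bool) :=
    (Icc (((p.1 : ℕ) : ℤ) - k) (((p.1 : ℕ) : ℤ) + k) ×ˢ univ).erase (((p.1 : ℕ) : ℤ), p.2)
  have hT : #T = 4 * k + 1 := by
    rw [card_erase_of_mem (by simp), card_product, Int.card_Icc, card_univ, Fintype.card_bool]
    omega
  rw [← hT]
  refine card_le_card_of_injOn (fun q => (((q.1 : ℕ) : ℤ), q.2)) ?_ ?_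
  · rintro ⟨a, b⟩ hq
    obtain ⟨x, y⟩ := p
    simp only [ne_eq, Prod.mk.injEq, coe_filter, mem_univ, true_and, Set.mem_ofPred_eq, abs_le,
      Fin.ext_iff] at hq
    simp only [T, coe_erase, Set.mem_sdiff, Set.mem_singleton_iff, Prod.mk.injEq, mem_coe,
      mem_product, mem_Icc, mem_univ, and_true, Nat.cast_inj]
    refine ⟨⟨?_, ?_⟩, hq.1⟩ <;> omega
  · rintro ⟨a, b⟩ _ ⟨x, y⟩ _ h
    simpa [Fin.ext_iff] using h

/-- Lower bound construction: `2n` points indexed by a column `m ∈ {1, …, n}` (modeled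
by `Fin n`) and a row `b ∈ {0, 1}` (modeled by `Bool`) are inserted in a uniformly
random order `σ : Fin (2n) ≃ Fin n × Bool`; the point inserted at 1-based time `t + 1`
(for `t : Fin (2n)`) is `σ t`. For an insertion time `j` with `1 ≤ j + 1 ≤ n / 20` and
`ξ = ⌈n / (8 (j + 1))⌉`, the point inserted at time `j + 1` is isolated if every other
point whose column is within `ξ` of its column is inserted strictly after time `j + 1`.
For all sufficiently large `n`, the probability that this point is isolated is at least
`1/2`. -/
theorem isolated_probability_ge_half :
    ∃ N : ℕ, ∀ n : ℕ, N ≤ n → ∀ j : Fin (2 * n), 20 * ((j : ℕ) + 1) ≤ n →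
      (1 : ℝ) / 2 ≤
        ((Finset.univ.filter fun σ : Fin (2 * n) ≃ Fin n × Bool =>
            ∀ q : Fin n × Bool, q ≠ σ j →
              |((q.1 : ℕ) : ℤ) - (((σ j).1 : ℕ) : ℤ)| ≤
                  ⌈(n : ℚ) / (8 * ((j : ℕ) + 1))⌉ →
                j < σ.symm q).card : ℝ) /
          (Nat.factorial (2 * n) : ℝ) := by
  refine ⟨1, fun n hn j hj => ?_⟩
  obtain ⟨k, hk⟩ : ∃ k : ℕ, ⌈(n : ℚ) / (8 * ((j : ℕ) + 1))⌉ = k :=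
    Int.eq_ofNat_of_zero_le (Int.ceil_nonneg (by positivity))
  rw [hk]
  set good := Finset.univ.filter fun σ : Fin (2 * n) ≃ Fin n × Bool =>
    ∀ q : Fin n × Bool, q ≠ σ j →
      |((q.1 : ℕ) : ℤ) - (((σ j).1 : ℕ) : ℤ)| ≤ (k : ℤ) → j < σ.symm q with hgood
  have ceil_bound : 8 * (j + 1) * k ≤ n + 8 * ((j : ℕ) + 1) := by
    have h := Int.ceil_lt_add_one ((n : ℚ) / (8 * ((j : ℕ) + 1)))
    rw [hk] at h
    have hpos : (0 : ℚ) < 8 * ((j : ℕ) + 1) := by positivity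
    have h2 := mul_le_mul_of_nonneg_left h.le hpos.le
    rw [mul_add (8 * ((j : ℕ) + 1) : ℚ), mul_div_cancel₀ _ hpos.ne', mul_one] at h2
    exact_mod_cast h2
  have hbad := card_equiv_exists_rel_le
    (fun p q : Fin n × Bool => |((q.1 : ℕ) : ℤ) - ((p.1 : ℕ) : ℤ)| ≤ (k : ℤ)) (4 * k + 1)
    (card_columns_near_le n k) j (Finset.Iio j) (by simp)
  set bad := Finset.univ.filter fun σ : Fin (2 * n) ≃ Fin n × Bool =>
    ∃ i ∈ Finset.Iio j, |(((σ i).1 : ℕ) : ℤ) - (((σ j).1 : ℕ) : ℤ)| ≤ (k : ℤ) with hbaddef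
  have htotal : Fintype.card (Fin (2 * n) ≃ Fin n × Bool) = (2 * n).factorial := by
    rw [Fintype.card_equiv (Fintype.equivOfCardEq (by simp [mul_comm])), Fintype.card_fin]
  have hcover : (2 * n).factorial ≤ good.card + bad.card := by
    rw [← htotal, ← Finset.card_univ]
    refine le_trans (Finset.card_le_card ?_) (Finset.card_union_le good bad)
    intro σ _
    by_contra h
    simp only [hgood, hbaddef, Finset.mem_union, Finset.mem_filter, Finset.mem_univ, true_and,
      not_or, not_forall, not_lt] at h
    obtain ⟨⟨q, hq, hnear, hle⟩, hno⟩ := h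
    refine hno ⟨σ.symm q, Finset.mem_Iio.2 (lt_of_le_of_ne hle ?_), by simpa using hnear⟩
    rintro rfl
    simp at hq
  rw [htotal, Fintype.card_fin, Fin.card_Iio] at hbad
  replace hbad : (2 * n - 1) * bad.card ≤ (j : ℕ) * ((4 * k + 1) * (2 * n).factorial) := by
    convert hbad
  have hsmall : 2 * ((j : ℕ) * (4 * k + 1)) ≤ 2 * n - 1 := by
    have : (j : ℕ) * k ≤ (j + 1) * k := Nat.mul_le_mul_right _ (Nat.le_succ _)
    have h1 : 8 * (j + 1) * k = 8 * (((j : ℕ) + 1) * k) := by ring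
    have h2 : 2 * ((j : ℕ) * (4 * k + 1)) = 8 * (j * k) + 2 * j := by ring
    omega
  have hhalf : 2 * bad.card ≤ (2 * n).factorial := by
    refine Nat.le_of_mul_le_mul_left (c := 2 * n - 1) ?_ (by omega)
    calc (2 * n - 1) * (2 * bad.card) = 2 * ((2 * n - 1) * bad.card) := by ring
      _ ≤ 2 * ((j : ℕ) * ((4 * k + 1) * (2 * n).factorial)) := Nat.mul_le_mul_left _ hbad
      _ = 2 * ((j : ℕ) * (4 * k + 1)) * (2 * n).factorial := by ring
      _ ≤ _ := Nat.mul_le_mul_right _ hsmall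
  have hgoodhalf : (2 * n).factorial ≤ 2 * good.card := by omega
  rw [div_le_div_iff₀ two_pos (by positivity), one_mul, mul_comm (good.card : ℝ)]
  exact_mod_cast hgoodhalf
end
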